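/- arXiv:1605.05137 — 7 statements merged into one kernel-verified Lean document; each statement's English description precedes it below -/
import Mathlib

section
/- Fix maximum powers P0 > 0 and PU > 0 and assume g_D, g_U, g_I, g_S ≥ 0 and σ0², σD² > 0. Then the maximum of φ over the rectangle [0,P0] × [0,PU] is attained at one of the four corner points, i.e., max over (x,y) ∈ [0,P0]×[0,PU] of φ(x,y) equals the maximum of φ over the set {0,P0} × {0,PU}. In other words, the sum-rate-optimal power allocation is binary in each coordinate. -/
open Set

/-- A function `t ↦ a t + b (1 + a t) / (s t + c)` with `a, s ≥ 0` and `c > 0` is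
bounded on `[0, P]` by its larger endpoint value. -/
theorem linear_add_moebius_le_endpoint {a b s c P x : ℝ} (ha : 0 ≤ a) (hs : 0 ≤ s)
    (hc : 0 < c) (hx : 0 ≤ x) (hxP : x ≤ P) :
    a * x + b * (1 + a * x) / (x * s + c) ≤ b / c ∨
      a * x + b * (1 + a * x) / (x * s + c) ≤ a * P + b * (1 + a * P) / (P * s + c) := by
  have hxs : 0 < x * s + c := by positivity
  have hPs : 0 < P * s + c := by have := hx.trans hxP; positivity
  have hP : a * P + b * (1 + a * P) / (P * s + c) - (a * x + b * (1 + a * x) / (x * s + c)) =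
      (P - x) * (a - b * (s - a * c) / ((P * s + c) * (x * s + c))) := by
    field_simp
    ring
  have h0 : b / c - (a * x + b * (1 + a * x) / (x * s + c)) =
      x * (b * (s - a * c) / (c * (x * s + c)) - a) := by
    field_simp
    ring
  rcases le_or_gt (b * (s - a * c) / ((P * s + c) * (x * s + c))) a with h | h
  · right
    have := mul_nonneg (sub_nonneg.2 hxP) (sub_nonneg.2 h)
    linarith
  · left
    have hnum : 0 ≤ b * (s - a * c) := by
      by_contra! hneg
      have := div_neg_of_neg_of_pos hneg (mul_pos hPs hxs)
      linarith
    have hle : b * (s - a * c) / ((P * s + c) * (x * s + c)) ≤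
        b * (s - a * c) / (c * (x * s + c)) := by
      have hcP : c ≤ P * s + c := by nlinarith [mul_nonneg (hx.trans hxP) hs]
      gcongr
    have := mul_nonneg hx (sub_nonneg.2 (h.le.trans hle))
    linarith

/-- A function on a rectangle that, along each coordinate, is bounded by one of its two endpoint
values attains its maximum at a corner. -/
theorem exists_corner_forall_le {P Q : ℝ} (hP : 0 ≤ P) (f : ℝ → ℝ → ℝ)
    (hfst : ∀ x ∈ Icc 0 P, ∀ y ∈ Icc 0 Q, f x y ≤ f 0 y ∨ f x y ≤ f P y)
    (hsnd : ∀ x ∈ Icc 0 P, ∀ y ∈ Icc 0 Q, f x y ≤ f x 0 ∨ f x y ≤ f x Q) :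
    ∃ p ∈ (({0, P} : Set ℝ) ×ˢ ({0, Q} : Set ℝ)),
      ∀ q ∈ Icc (0 : ℝ) P ×ˢ Icc (0 : ℝ) Q, f q.1 q.2 ≤ f p.1 p.2 := by
  have hfin : (({0, P} : Set ℝ) ×ˢ ({0, Q} : Set ℝ)).Finite := (toFinite _).prod (toFinite _)
  obtain ⟨p, hp, hmax⟩ := Set.exists_max_image _ (fun p : ℝ × ℝ => f p.1 p.2) hfin
    ⟨(0, 0), by simp⟩
  refine ⟨p, hp, ?_⟩
  have key : ∀ x ∈ ({0, P} : Set ℝ), ∀ y ∈ Icc (0 : ℝ) Q, f x y ≤ f p.1 p.2 := by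
    intro x hx y hy
    have hxI : x ∈ Icc (0 : ℝ) P := by
      rcases hx with rfl | rfl
      exacts [left_mem_Icc.2 hP, right_mem_Icc.2 hP]
    rcases hsnd x hxI y hy with h | h
    · exact h.trans (hmax (x, 0) ⟨hx, by simp⟩)
    · exact h.trans (hmax (x, Q) ⟨hx, by simp⟩)
  rintro ⟨x, y⟩ ⟨hx, hy⟩
  rcases hfst x hx y hy with h | h
  · exact h.trans (key 0 (by simp) y hy)
  · exact h.trans (key P (by simp) y hy)

/-- The sum-rate-optimal full-duplex power allocation is binary: the maximum of `φ`
over the rectangle `[0, P0] × [0, PU]` is attained at one of the four corner points. -/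
theorem opa_binary (gD gU gI gS σ0sq σDsq P0 PU : ℝ)
    (hgD : 0 ≤ gD) (hgU : 0 ≤ gU) (hgI : 0 ≤ gI) (hgS : 0 ≤ gS)
    (hσ0 : 0 < σ0sq) (hσD : 0 < σDsq) (hP0 : 0 < P0) (hPU : 0 < PU)
    (φ : ℝ → ℝ → ℝ)
    (hφ : ∀ x y, φ x y = x * gD / (y * gI + σDsq) + y * gU / (x * gS + σ0sq)
      + x * y * gD * gU / ((y * gI + σDsq) * (x * gS + σ0sq))) :
    ∃ p ∈ (({0, P0} : Set ℝ) ×ˢ ({0, PU} : Set ℝ)),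
      ∀ q ∈ Icc (0:ℝ) P0 ×ˢ Icc (0:ℝ) PU, φ q.1 q.2 ≤ φ p.1 p.2 := by
  refine exists_corner_forall_le hP0.le φ ?_ ?_
  · rintro x ⟨hx0, hxP⟩ y ⟨hy0, -⟩
    have hD : 0 < y * gI + σDsq := by positivity
    have hform : ∀ t, φ t y = gD / (y * gI + σDsq) * t
        + y * gU * (1 + gD / (y * gI + σDsq) * t) / (t * gS + σ0sq) := by
      intro t
      rw [hφ, ← div_div]
      ring
    have h := linear_add_moebius_le_endpoint (b := y * gU) (div_nonneg hgD hD.le) hgS hσ0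
      hx0 hxP
    rw [hform x, hform 0, hform P0]
    simpa using h
  · rintro x ⟨hx0, -⟩ y ⟨hy0, hyP⟩
    have hS : 0 < x * gS + σ0sq := by positivity
    have hform : ∀ t, φ x t = gU / (x * gS + σ0sq) * t
        + x * gD * (1 + gU / (x * gS + σ0sq) * t) / (t * gI + σDsq) := by
      intro t
      rw [hφ, ← div_div]
      ring
    have h := linear_add_moebius_le_endpoint (b := x * gD) (div_nonneg hgU hS.le) hgI hσD
      hy0 hyP
    rw [hform y, hform 0, hform PU]
    simpa using h
end

section
/- Fix maximum powers P0 > 0 and PU > 0 and assume g_D, g_U, g_I, g_S ≥ 0 and σ0², σD² > 0. If ζ(P0) ≥ 0 and η(PU) ≥ 0, then φ(P0,PU) ≥ φ(x,y) for all (x,y) ∈ [0,P0] × [0,PU]; that is, full-duplex operation with maximum transmit powers (p0*, pU*) = (P0, PU) maximizes the sum rate. -/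
open Set

/-- For a fixed power `y` with `gS * (y * gI + d) ≤ gD * s`, the full-duplex rate expression is
nondecreasing in the other power. -/
theorem fd_rate_le_of_le {gD gU gI gS s d x x' y : ℝ}
    (hgD : 0 ≤ gD) (hgU : 0 ≤ gU) (hgI : 0 ≤ gI) (hgS : 0 ≤ gS) (hs : 0 < s) (hd : 0 < d)
    (hx : 0 ≤ x) (hxx' : x ≤ x') (hy : 0 ≤ y) (h : gS * (y * gI + d) ≤ gD * s) :
    x * gD / (y * gI + d) + y * gU / (x * gS + s)
      + x * y * gD * gU / ((y * gI + d) * (x * gS + s)) ≤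
    x' * gD / (y * gI + d) + y * gU / (x' * gS + s)
      + x' * y * gD * gU / ((y * gI + d) * (x' * gS + s)) := by
  have hx' : 0 ≤ x' := hx.trans hxx'
  have hu : 0 < y * gI + d := by positivity
  have rewrite_rate : ∀ z, 0 ≤ z → z * gD / (y * gI + d) + y * gU / (z * gS + s)
      + z * y * gD * gU / ((y * gI + d) * (z * gS + s)) =
      z * gD / (y * gI + d)
        + y * gU / (y * gI + d) * ((y * gI + d + z * gD) / (z * gS + s)) := by
    intro z hz
    have hv : 0 < z * gS + s := by positivity
    field_simp
    ring
  have hratio : (y * gI + d + x * gD) / (x * gS + s) ≤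
      (y * gI + d + x' * gD) / (x' * gS + s) := by
    rw [div_le_div_iff₀ (by positivity) (by positivity)]
    nlinarith [mul_nonneg (sub_nonneg.2 hxx') (sub_nonneg.2 h)]
  rw [rewrite_rate x hx, rewrite_rate x' hx']
  gcongr

/-- If `ζ(P0) ≥ 0` and `η(PU) ≥ 0`, then full-duplex operation with maximum transmit
powers `(p0⋆, pU⋆) = (P0, PU)` maximizes the sum rate: `φ(P0, PU) ≥ φ(x, y)` for all
`(x, y) ∈ [0, P0] × [0, PU]`. -/
theorem fd_max_power_optimal (gD gU gI gS σ0sq σDsq P0 PU : ℝ)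
    (hgD : 0 ≤ gD) (hgU : 0 ≤ gU) (hgI : 0 ≤ gI) (hgS : 0 ≤ gS)
    (hσ0 : 0 < σ0sq) (hσD : 0 < σDsq) (hP0 : 0 < P0) (hPU : 0 < PU)
    (φ : ℝ → ℝ → ℝ)
    (hφ : ∀ x y, φ x y = x * gD / (y * gI + σDsq) + y * gU / (x * gS + σ0sq)
      + x * y * gD * gU / ((y * gI + σDsq) * (x * gS + σ0sq)))
    (hζ : 0 ≤ gU * σDsq / (P0 * gS + σ0sq) - gI)
    (hη : 0 ≤ gD * σ0sq / (PU * gI + σDsq) - gS) :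
    ∀ x ∈ Icc (0:ℝ) P0, ∀ y ∈ Icc (0:ℝ) PU, φ x y ≤ φ P0 PU := by
  rintro x ⟨hx, hxP⟩ y ⟨hy, hyP⟩
  rw [sub_nonneg, le_div_iff₀ (by positivity)] at hζ hη
  have hη' : gS * (y * gI + σDsq) ≤ gD * σ0sq :=
    le_trans (by gcongr) hη
  calc φ x y ≤ φ P0 y := by
        rw [hφ, hφ]
        exact fd_rate_le_of_le hgD hgU hgI hgS hσ0 hσD hx hxP hy hη'
    _ ≤ φ P0 PU := by
        have key := fd_rate_le_of_le hgU hgD hgS hgI hσD hσ0 hy hyP hP0.le hζ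
        rw [hφ, hφ]
        convert key using 1 <;> ring
end

section
/- Fix maximum powers P0 > 0 and PU > 0, assume g_D > 0, g_U > 0, g_I, g_S ≥ 0 and σ0², σD² > 0. Then the maximum of φ over the rectangle [0,P0] × [0,PU] is attained at one of the three points (P0,PU), (0,PU), (P0,0); i.e., the optimal power allocation is either full-duplex with maximum powers, half-duplex uplink with maximum uplink power, or half-duplex downlink with maximum downlink power (the point (0,0) is never optimal). -/
open Set

/-- On an interval `[0, P]`, the function `x ↦ a x + b / (s x + c) + x a b / (s x + c)` is bounded
by the larger of its endpoint values. -/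
theorem le_left_or_le_right_endpoint {a b s c x P : ℝ} (ha : 0 ≤ a)
    (hs : 0 ≤ s) (hc : 0 < c) (hx : 0 ≤ x) (hxP : x ≤ P) :
    x * a + b / (x * s + c) + x * a * b / (x * s + c) ≤ b / c ∨
      x * a + b / (x * s + c) + x * a * b / (x * s + c) ≤
        P * a + b / (P * s + c) + P * a * b / (P * s + c) := by
  have hP : 0 ≤ P := hx.trans hxP
  have hdx : 0 < x * s + c := by positivity
  have hdP : 0 < P * s + c := by positivity
  rcases le_total (a * c * (x * s + c) + b * (a * c - s)) 0 with h | h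
  · left
    have key : x * a + b / (x * s + c) + x * a * b / (x * s + c) - b / c =
        x * (a * c * (x * s + c) + b * (a * c - s)) / (c * (x * s + c)) := by
      field_simp
      ring
    have := div_nonpos_of_nonpos_of_nonneg (mul_nonpos_of_nonneg_of_nonpos hx h)
      (mul_pos hc hdx).le
    linarith
  · right
    have key : P * a + b / (P * s + c) + P * a * b / (P * s + c) -
        (x * a + b / (x * s + c) + x * a * b / (x * s + c)) =
        (P - x) * (a * (P * s + c) * (x * s + c) + b * (a * c - s)) /
          ((P * s + c) * (x * s + c)) := by
      field_simp
      ring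
    have h' : 0 ≤ a * (P * s + c) * (x * s + c) + b * (a * c - s) := by
      have : 0 ≤ a * (P * s) * (x * s + c) := by positivity
      linarith
    have := div_nonneg (mul_nonneg (sub_nonneg.2 hxP) h') (mul_pos hdP hdx).le
    linarith

/-- With strictly positive desired-link gains, the maximum of `φ` over the rectangle
`[0, P0] × [0, PU]` is attained at one of the three points `(P0, PU)`, `(0, PU)`,
`(P0, 0)`: full duplex with maximum powers, half-duplex uplink, or half-duplex
downlink (the point `(0, 0)` is never optimal). -/
theorem opa_three_candidates (gD gU gI gS σ0sq σDsq P0 PU : ℝ)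
    (hgD : 0 < gD) (hgU : 0 < gU) (hgI : 0 ≤ gI) (hgS : 0 ≤ gS)
    (hσ0 : 0 < σ0sq) (hσD : 0 < σDsq) (hP0 : 0 < P0) (hPU : 0 < PU)
    (φ : ℝ → ℝ → ℝ)
    (hφ : ∀ x y, φ x y = x * gD / (y * gI + σDsq) + y * gU / (x * gS + σ0sq)
      + x * y * gD * gU / ((y * gI + σDsq) * (x * gS + σ0sq))) :
    ∃ p ∈ ({(P0, PU), (0, PU), (P0, 0)} : Set (ℝ × ℝ)),
      ∀ q ∈ Icc (0:ℝ) P0 ×ˢ Icc (0:ℝ) PU, φ q.1 q.2 ≤ φ p.1 p.2 := by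
  have hX : ∀ x y, 0 ≤ x → x ≤ P0 → 0 ≤ y → φ x y ≤ φ 0 y ∨ φ x y ≤ φ P0 y := by
    intro x y hx hxP hy
    have hd : 0 < y * gI + σDsq := by positivity
    have h := le_left_or_le_right_endpoint (b := y * gU) (div_nonneg hgD.le hd.le) hgS hσ0 hx hxP
    have e : ∀ t, φ t y = t * (gD / (y * gI + σDsq)) + y * gU / (t * gS + σ0sq) +
        t * (gD / (y * gI + σDsq)) * (y * gU) / (t * gS + σ0sq) := by
      intro t
      rw [hφ, ← div_div]
      ring
    rw [e x, e P0, e 0]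
    simpa using h
  have hY : ∀ x y, 0 ≤ x → 0 ≤ y → y ≤ PU → φ x y ≤ φ x 0 ∨ φ x y ≤ φ x PU := by
    intro x y hx hy hyP
    have hd : 0 < x * gS + σ0sq := by positivity
    have h := le_left_or_le_right_endpoint (b := x * gD) (div_nonneg hgU.le hd.le) hgI hσD hy hyP
    have e : ∀ t, φ x t = t * (gU / (x * gS + σ0sq)) + x * gD / (t * gI + σDsq) +
        t * (gU / (x * gS + σ0sq)) * (x * gD) / (t * gI + σDsq) := by
      intro t
      rw [hφ, ← div_div]
      ring
    rw [e y, e PU, e 0]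
    simpa using h
  have h0 : ∀ y, y ≤ PU → φ 0 y ≤ φ 0 PU := by
    intro y hy
    simp only [hφ, zero_mul, zero_div, zero_add, add_zero]
    gcongr
  have hbound : ∀ x y, 0 ≤ x → x ≤ P0 → 0 ≤ y → y ≤ PU →
      φ x y ≤ φ P0 PU ∨ φ x y ≤ φ 0 PU ∨ φ x y ≤ φ P0 0 := by
    intro x y hx hxP hy hyP
    rcases hX x y hx hxP hy with h | h
    · exact .inr (.inl (h.trans (h0 y hyP)))
    · rcases hY P0 y hP0.le hy hyP with h' | h'
      · exact .inr (.inr (h.trans h'))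
      · exact .inl (h.trans h')
  obtain ⟨p, hp, hmax⟩ := Set.exists_max_image ({(P0, PU), (0, PU), (P0, 0)} : Set (ℝ × ℝ))
    (fun p => φ p.1 p.2) (Set.toFinite _) ⟨(P0, PU), by simp⟩
  refine ⟨p, hp, ?_⟩
  rintro ⟨x, y⟩ ⟨⟨hx, hxP⟩, hy, hyP⟩
  rcases hbound x y hx hxP hy hyP with h | h | h
  · exact h.trans (hmax (P0, PU) (by simp))
  · exact h.trans (hmax (0, PU) (by simp))
  · exact h.trans (hmax (P0, 0) (by simp))
end

section
/- Assume g_D, g_I, g_S ≥ 0, g_U > 0 and σ0², σD² > 0. Fix x ≥ 0 with ζ(x) ≥ 0. Then the map y ↦ φ(x,y) is strictly increasing and concave on [0,∞); in particular, for any PU > 0 its maximum over [0,PU] is attained uniquely at y = PU. -/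
open Set

/-- The difference of two values of the linear fractional map `y ↦ (1 + c y) / (y b + s)`. -/
lemma linearFractional_sub {b c s u v : ℝ} (hu : u * b + s ≠ 0) (hv : v * b + s ≠ 0) :
    (1 + c * v) / (v * b + s) - (1 + c * u) / (u * b + s)
      = (c * s - b) * (v - u) / ((u * b + s) * (v * b + s)) := by
  rw [div_sub_div _ _ hv hu, mul_comm (u * b + s)]
  congr 1
  ring

lemma monotoneOn_linearFractional {b c s : ℝ} (hb : 0 ≤ b) (hs : 0 < s) (hk : 0 ≤ c * s - b) :
    MonotoneOn (fun y : ℝ => (1 + c * y) / (y * b + s)) (Ici 0) := by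
  intro u hu v hv huv
  rw [mem_Ici] at hu hv
  have hdu : 0 < u * b + s := by positivity
  have hdv : 0 < v * b + s := by positivity
  rw [← sub_nonneg, linearFractional_sub hdu.ne' hdv.ne']
  exact div_nonneg (mul_nonneg hk (sub_nonneg.2 huv)) (by positivity)

lemma concaveOn_linearFractional {b c s : ℝ} (hb : 0 ≤ b) (hs : 0 < s) (hk : 0 ≤ c * s - b) :
    ConcaveOn ℝ (Ici 0) (fun y : ℝ => (1 + c * y) / (y * b + s)) := by
  refine ⟨convex_Ici 0, fun u hu v hv p q hp hq hpq => ?_⟩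
  rw [mem_Ici] at hu hv
  simp only [smul_eq_mul]
  obtain rfl : p = 1 - q := by linarith
  have hdu : 0 < u * b + s := by positivity
  have hdv : 0 < v * b + s := by positivity
  have hdz : 0 < ((1 - q) * u + q * v) * b + s := by positivity
  have key : (1 + c * ((1 - q) * u + q * v)) / (((1 - q) * u + q * v) * b + s)
      - ((1 - q) * ((1 + c * u) / (u * b + s)) + q * ((1 + c * v) / (v * b + s)))
      = (c * s - b) * ((1 - q) * q * b * (v - u) ^ 2)
        / ((((1 - q) * u + q * v) * b + s) * (u * b + s) * (v * b + s)) := by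
    have hdu' := hdu.ne'
    have hdv' := hdv.ne'
    have hdz' := hdz.ne'
    field_simp
    ring
  rw [← sub_nonneg, key]
  exact div_nonneg (mul_nonneg hk (by positivity)) (by positivity)

/-- If `ζ(x) ≥ 0`, then `y ↦ φ(x, y)` is strictly increasing and concave on `[0, ∞)`;
in particular, for any `PU > 0` its maximum over `[0, PU]` is attained uniquely at
`y = PU`. -/
theorem phi_strictMono_concave_in_y (gD gU gI gS σ0sq σDsq x : ℝ)
    (hgD : 0 ≤ gD) (hgU : 0 < gU) (hgI : 0 ≤ gI) (hgS : 0 ≤ gS)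
    (hσ0 : 0 < σ0sq) (hσD : 0 < σDsq) (hx : 0 ≤ x)
    (φ : ℝ → ℝ → ℝ)
    (hφ : ∀ x y, φ x y = x * gD / (y * gI + σDsq) + y * gU / (x * gS + σ0sq)
      + x * y * gD * gU / ((y * gI + σDsq) * (x * gS + σ0sq)))
    (hζ : 0 ≤ gU * σDsq / (x * gS + σ0sq) - gI) :
    StrictMonoOn (fun y => φ x y) (Ici 0) ∧
    ConcaveOn ℝ (Ici 0) (fun y => φ x y) ∧
    ∀ PU : ℝ, 0 < PU → ∀ y ∈ Icc (0:ℝ) PU, y ≠ PU → φ x y < φ x PU := by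
  have hA : 0 < x * gS + σ0sq := by positivity
  set c := gU / (x * gS + σ0sq) with hc
  have hc0 : 0 < c := div_pos hgU hA
  have hk : 0 ≤ c * σDsq - gI := by rwa [hc, div_mul_eq_mul_div]
  have ha : 0 ≤ x * gD := mul_nonneg hx hgD
  have hφ' : (fun y => φ x y)
      = fun y => c * y + (x * gD) * ((1 + c * y) / (y * gI + σDsq)) := by
    funext y
    rw [hφ, hc, mul_comm (y * gI + σDsq), ← div_div]
    ring
  have hmono : StrictMonoOn (fun y => φ x y) (Ici 0) := by
    rw [hφ']
    intro u hu v hv huv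
    exact add_lt_add_of_lt_of_le (mul_lt_mul_of_pos_left huv hc0)
      (mul_le_mul_of_nonneg_left (monotoneOn_linearFractional hgI hσD hk hu hv huv.le) ha)
  refine ⟨hmono, ?_, fun PU hPU y hy hne =>
    hmono hy.1 hPU.le (lt_of_le_of_ne hy.2 hne)⟩
  rw [hφ']
  exact ((LinearMap.mul ℝ ℝ c).concaveOn (convex_Ici 0)).add
    ((concaveOn_linearFractional hgI hσD hk).smul ha)
end

section
/- Assume g_D > 0, g_I > 0, g_U, g_S ≥ 0 and σ0², σD² > 0. Fix x > 0 with ζ(x) < 0. Then the map y ↦ φ(x,y) is strictly convex on [0,∞); in particular, for any PU > 0 its maximum over the interval [0,PU] is attained at an endpoint y ∈ {0, PU}. -/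
theorem strictConvexOn_const_add_mul_add_div {k a c g s : ℝ} (hc : 0 < c) (hg : 0 < g)
    (hs : 0 < s) : StrictConvexOn ℝ (Set.Ici 0) (fun y : ℝ => k + a * y + c / (y * g + s)) := by
  refine ⟨convex_Ici 0, fun u hu v hv huv p q hp hq hpq => ?_⟩
  rw [Set.mem_Ici] at hu hv
  obtain rfl : q = 1 - p := by linarith
  simp only [smul_eq_mul]
  have hU : 0 < u * g + s := by positivity
  have hV : 0 < v * g + s := by positivity
  have hW : 0 < (p * u + (1 - p) * v) * g + s := by positivity
  have hsq : 0 < (u - v) ^ 2 := sq_pos_of_ne_zero (sub_ne_zero.2 huv)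
  have gap : p * (k + a * u + c / (u * g + s)) + (1 - p) * (k + a * v + c / (v * g + s))
      - (k + a * (p * u + (1 - p) * v) + c / ((p * u + (1 - p) * v) * g + s))
      = c * p * (1 - p) * g ^ 2 * (u - v) ^ 2
        / ((u * g + s) * (v * g + s) * ((p * u + (1 - p) * v) * g + s)) := by
    field_simp
    ring
  rw [← sub_pos, gap]
  positivity

open Set

/-- If `ζ(x) < 0`, then `y ↦ φ(x, y)` is strictly convex on `[0, ∞)`; in particular,
for any `PU > 0` its maximum over `[0, PU]` is attained at an endpoint `y ∈ {0, PU}`. -/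
theorem phi_strictConvex_in_y (gD gU gI gS σ0sq σDsq x : ℝ)
    (hgD : 0 < gD) (hgU : 0 ≤ gU) (hgI : 0 < gI) (hgS : 0 ≤ gS)
    (hσ0 : 0 < σ0sq) (hσD : 0 < σDsq) (hx : 0 < x)
    (φ : ℝ → ℝ → ℝ)
    (hφ : ∀ x y, φ x y = x * gD / (y * gI + σDsq) + y * gU / (x * gS + σ0sq)
      + x * y * gD * gU / ((y * gI + σDsq) * (x * gS + σ0sq)))
    (hζ : gU * σDsq / (x * gS + σ0sq) - gI < 0) :
    StrictConvexOn ℝ (Ici 0) (fun y => φ x y) ∧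
    ∀ PU : ℝ, 0 < PU → ∀ y ∈ Icc (0:ℝ) PU, φ x y ≤ max (φ x 0) (φ x PU) := by
  have hB : 0 < x * gS + σ0sq := by positivity
  have hc : 0 < x * gD * (gI - gU * σDsq / (x * gS + σ0sq)) / gI :=
    div_pos (mul_pos (mul_pos hx hgD) (by linarith)) hgI
  have hconv : StrictConvexOn ℝ (Ici 0) (fun y => φ x y) := by
    refine (strictConvexOn_const_add_mul_add_div (k := x * gD * gU / ((x * gS + σ0sq) * gI))
      (a := gU / (x * gS + σ0sq)) hc hgI hσD).congr fun y hy => ?_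
    rw [mem_Ici] at hy
    have hA : 0 < y * gI + σDsq := by positivity
    simp only [hφ]
    field_simp
    ring
  exact ⟨hconv, fun PU hPU y hy =>
    hconv.convexOn.le_max_of_mem_Icc self_mem_Ici hPU.le hy⟩
end

section
/- Assume g_D > 0, g_U, g_I, g_S ≥ 0 and σ0², σD² > 0. Fix y ≥ 0 with η(y) ≥ 0. Then the map x ↦ φ(x,y) is strictly increasing and concave on [0,∞); in particular, for any P0 > 0 its maximum over [0,P0] is attained uniquely at x = P0. -/
open Set

theorem monotoneOn_linear_fractional {a s n : ℝ} (hs : 0 ≤ s) (hn : 0 < n)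
    (hk : 0 ≤ a * n - s) : MonotoneOn (fun x : ℝ => (1 + a * x) / (s * x + n)) (Ici 0) := by
  intro x hx z hz hxz
  rw [mem_Ici] at hx hz
  have hx' : 0 < s * x + n := by positivity
  have hz' : 0 < s * z + n := by positivity
  change (1 + a * x) / (s * x + n) ≤ (1 + a * z) / (s * z + n)
  rw [div_le_div_iff₀ hx' hz']
  nlinarith [mul_nonneg hk (sub_nonneg.2 hxz)]

/-- A linear fractional function lies below its tangent line at `w`. -/
theorem linear_fractional_le_tangent {a s n x w : ℝ} (hs : 0 ≤ s) (hn : 0 < n)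
    (hk : 0 ≤ a * n - s) (hx : 0 ≤ x) (hw : 0 ≤ w) :
    (1 + a * x) / (s * x + n)
      ≤ (1 + a * w) / (s * w + n) + (a * n - s) / (s * w + n) ^ 2 * (x - w) := by
  have hx' : 0 < s * x + n := by positivity
  have hw' : 0 < s * w + n := by positivity
  have key : (1 + a * w) / (s * w + n) + (a * n - s) / (s * w + n) ^ 2 * (x - w)
      - (1 + a * x) / (s * x + n)
      = (a * n - s) * s * (x - w) ^ 2 / ((s * w + n) ^ 2 * (s * x + n)) := by
    field_simp
    ring
  have hnonneg : 0 ≤ (a * n - s) * s * (x - w) ^ 2 / ((s * w + n) ^ 2 * (s * x + n)) := by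
    positivity
  linarith

theorem concaveOn_linear_fractional {a s n : ℝ} (hs : 0 ≤ s) (hn : 0 < n)
    (hk : 0 ≤ a * n - s) : ConcaveOn ℝ (Ici 0) (fun x : ℝ => (1 + a * x) / (s * x + n)) := by
  refine ⟨convex_Ici 0, ?_⟩
  intro x hx z hz p q hp hq hpq
  have hw : 0 ≤ p * x + q * z := add_nonneg (mul_nonneg hp hx) (mul_nonneg hq hz)
  simp only [smul_eq_mul]
  have h1 := mul_le_mul_of_nonneg_left (linear_fractional_le_tangent hs hn hk hx hw) hp
  have h2 := mul_le_mul_of_nonneg_left (linear_fractional_le_tangent hs hn hk hz hw) hq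
  obtain rfl : q = 1 - p := by linarith
  refine (add_le_add h1 h2).trans (le_of_eq ?_)
  ring

/-- If `η(y) ≥ 0`, then `x ↦ φ(x, y)` is strictly increasing and concave on `[0, ∞)`;
in particular, for any `P0 > 0` its maximum over `[0, P0]` is attained uniquely at
`x = P0`. -/
theorem phi_strictMono_concave_in_x (gD gU gI gS σ0sq σDsq y : ℝ)
    (hgD : 0 < gD) (hgU : 0 ≤ gU) (hgI : 0 ≤ gI) (hgS : 0 ≤ gS)
    (hσ0 : 0 < σ0sq) (hσD : 0 < σDsq) (hy : 0 ≤ y)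
    (φ : ℝ → ℝ → ℝ)
    (hφ : ∀ x y, φ x y = x * gD / (y * gI + σDsq) + y * gU / (x * gS + σ0sq)
      + x * y * gD * gU / ((y * gI + σDsq) * (x * gS + σ0sq)))
    (hη : 0 ≤ gD * σ0sq / (y * gI + σDsq) - gS) :
    StrictMonoOn (fun x => φ x y) (Ici 0) ∧
    ConcaveOn ℝ (Ici 0) (fun x => φ x y) ∧
    ∀ P0 : ℝ, 0 < P0 → ∀ x ∈ Icc (0:ℝ) P0, x ≠ P0 → φ x y < φ P0 y := by
  have hD : 0 < y * gI + σDsq := by positivity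
  set a := gD / (y * gI + σDsq) with ha
  have ha0 : 0 < a := div_pos hgD hD
  have hc : 0 ≤ y * gU := mul_nonneg hy hgU
  have hk : 0 ≤ a * σ0sq - gS := by
    rwa [ha, div_mul_eq_mul_div]
  have hform : ∀ x ∈ Ici (0 : ℝ),
      a * x + y * gU * ((1 + a * x) / (gS * x + σ0sq)) = φ x y := by
    intro x hx
    rw [mem_Ici] at hx
    have hx' : 0 < x * gS + σ0sq := by positivity
    rw [hφ, ha, mul_comm gS x]
    field_simp
    ring
  have hmono : StrictMonoOn (fun x => φ x y) (Ici 0) := by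
    intro x hx z hz hxz
    change φ x y < φ z y
    rw [← hform x hx, ← hform z hz]
    exact add_lt_add_of_lt_of_le (mul_lt_mul_of_pos_left hxz ha0)
      (mul_le_mul_of_nonneg_left
        (monotoneOn_linear_fractional hgS hσ0 hk hx hz hxz.le) hc)
  refine ⟨hmono, ?_, ?_⟩
  · have hlin : ConcaveOn ℝ (Ici 0) (fun x : ℝ => a * x) :=
      (concaveOn_id (convex_Ici 0)).smul ha0.le
    exact (hlin.add ((concaveOn_linear_fractional hgS hσ0 hk).smul hc)).congr hform
  · intro P0 hP0 x hx hne
    exact hmono hx.1 hP0.le (lt_of_le_of_ne hx.2 hne)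
end

section
/- Assume g_U > 0, g_S > 0, g_D, g_I ≥ 0 and σ0², σD² > 0. Fix y > 0 with η(y) < 0. Then the map x ↦ φ(x,y) is strictly convex on [0,∞); in particular, for any P0 > 0 its maximum over the interval [0,P0] is attained at an endpoint x ∈ {0, P0}. -/
open Set

/-- The reciprocal of a nonconstant affine function is strictly convex wherever the function is
positive. -/
theorem strictConvexOn_inv_affine {s : Set ℝ} (hs : Convex ℝ s) {p q : ℝ} (hp : p ≠ 0)
    (hpos : ∀ x ∈ s, 0 < p * x + q) : StrictConvexOn ℝ s (fun x => (p * x + q)⁻¹) := by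
  refine ⟨hs, fun u hu v hv huv a b ha hb hab => ?_⟩
  have hU := hpos u hu
  have hV := hpos v hv
  have hM := hpos _ (hs hu hv ha.le hb.le hab)
  simp only [smul_eq_mul] at hM ⊢
  have hdiff : a * (p * u + q)⁻¹ + b * (p * v + q)⁻¹ - (p * (a * u + b * v) + q)⁻¹
      = a * b * (p * (u - v)) ^ 2
        / ((p * u + q) * (p * v + q) * (p * (a * u + b * v) + q)) := by
    obtain rfl : b = 1 - a := by linarith
    field_simp
    ring
  have hsq : 0 < (p * (u - v)) ^ 2 := by
    have := mul_ne_zero hp (sub_ne_zero.mpr huv)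
    positivity
  rw [← sub_pos, hdiff]
  positivity

/-- If `η(y) < 0`, then `x ↦ φ(x, y)` is strictly convex on `[0, ∞)`; in particular,
for any `P0 > 0` its maximum over `[0, P0]` is attained at an endpoint `x ∈ {0, P0}`. -/
theorem phi_strictConvex_in_x (gD gU gI gS σ0sq σDsq y : ℝ)
    (hgD : 0 ≤ gD) (hgU : 0 < gU) (hgI : 0 ≤ gI) (hgS : 0 < gS)
    (hσ0 : 0 < σ0sq) (hσD : 0 < σDsq) (hy : 0 < y)
    (φ : ℝ → ℝ → ℝ)
    (hφ : ∀ x y, φ x y = x * gD / (y * gI + σDsq) + y * gU / (x * gS + σ0sq)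
      + x * y * gD * gU / ((y * gI + σDsq) * (x * gS + σ0sq)))
    (hη : gD * σ0sq / (y * gI + σDsq) - gS < 0) :
    StrictConvexOn ℝ (Ici 0) (fun x => φ x y) ∧
    ∀ P0 : ℝ, 0 < P0 → ∀ x ∈ Icc (0:ℝ) P0, φ x y ≤ max (φ 0 y) (φ P0 y) := by
  have hA : 0 < y * gI + σDsq := by positivity
  have hden : ∀ x ∈ Ici (0 : ℝ), 0 < gS * x + σ0sq := fun x hx => by
    have : 0 ≤ x := hx
    positivity
  set a := gD / (y * gI + σDsq) with ha
  have hc : 0 < y * gU * (gS - a * σ0sq) / gS := by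
    have : 0 < gS - a * σ0sq := by
      have : a * σ0sq = gD * σ0sq / (y * gI + σDsq) := by rw [ha]; ring
      linarith
    positivity
  have hdecomp : ∀ x ∈ Ici (0 : ℝ),
      a * x + y * gU * a / gS + y * gU * (gS - a * σ0sq) / gS * (gS * x + σ0sq)⁻¹ = φ x y := by
    intro x hx
    have hx' := hden x hx
    have hx'' : 0 < x * gS + σ0sq := by linarith
    rw [hφ, ha]
    field_simp
    ring
  have hconv : StrictConvexOn ℝ (Ici 0) (fun x => φ x y) := by
    have hinv := strictConvexOn_inv_affine (convex_Ici (0 : ℝ)) hgS.ne' hden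
    refine ⟨convex_Ici 0, fun u hu v hv huv s t hs ht hst => ?_⟩
    have h := mul_lt_mul_of_pos_left (hinv.2 hu hv huv hs ht hst) hc
    have hmem := convex_Ici (0 : ℝ) hu hv hs.le ht.le hst
    simp only [smul_eq_mul] at h hmem ⊢
    rw [← hdecomp u hu, ← hdecomp v hv, ← hdecomp _ hmem]
    linear_combination h - y * gU * a / gS * hst
  exact ⟨hconv, fun P0 hP0 x hx =>
    hconv.convexOn.le_max_of_mem_Icc (mem_Ici.mpr le_rfl) (mem_Ici.mpr hP0.le) hx⟩
end
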